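/- arXiv:1702.06468 — 2 statements merged into one kernel-verified Lean document; each statement's English description precedes it below -/
import Mathlib

section
/- Let 0<Δ<1. There exist constants C₁>0 and h₀∈(0,1), depending only on Δ, such that for every h∈(0,h₀) and every map y ∈ C²(cl(B₁); ℝ³) one has I_{h,Δ}(y) ≥ 2πΔ²h²(log(1/h) − C₁). -/
open MeasureTheory Metric Real Filter Matrix
open scoped ENNReal Topology

noncomputable section

/-- The plane `ℝ²` with the Euclidean norm. -/
abbrev E2 : Type := EuclideanSpace ℝ (Fin 2)
/-- The space `ℝ³` with the Euclidean norm. -/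
abbrev E3 : Type := EuclideanSpace ℝ (Fin 3)

/-- The `i`-th standard basis vector of `ℝ²`. -/
def e2 (i : Fin 2) : E2 := EuclideanSpace.single i 1

/-- Partial derivative in the direction of the `i`-th coordinate. -/
def pd (i : Fin 2) (f : E2 → ℝ) (x : E2) : ℝ := fderiv ℝ f x (e2 i)

/-- Hessian matrix of a scalar function on `ℝ²`. -/
def hess (f : E2 → ℝ) (x : E2) : Matrix (Fin 2) (Fin 2) ℝ :=
  Matrix.of fun i j => pd i (pd j f) x

/-- Derivative matrix `Dy ∈ ℝ^{3×2}` of a map `y : ℝ² → ℝ³`. -/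
def Dmat (y : E2 → E3) (x : E2) : Matrix (Fin 3) (Fin 2) ℝ :=
  Matrix.of fun i j => pd j (fun z => y z i) x

/-- Induced metric `g_y = (Dy)ᵀ Dy`. -/
def gmet (y : E2 → E3) (x : E2) : Matrix (Fin 2) (Fin 2) ℝ :=
  (Dmat y x)ᵀ * Dmat y x

/-- The rotated vector `x⊥ = (-x₂, x₁)`. -/
def perpVec (x : E2) : Fin 2 → ℝ := ![-(x 1), x 0]

/-- The unit tangent `x̂⊥ = (-x₂, x₁)/|x|`. -/
def xperpUnit (x : E2) : Fin 2 → ℝ := fun i => perpVec x i / ‖x‖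

/-- The reference (cone) metric `g_Δ = Id - Δ² x̂⊥ ⊗ x̂⊥`. -/
def gDelta (Δ : ℝ) (x : E2) : Matrix (Fin 2) (Fin 2) ℝ :=
  1 - Matrix.of fun i j => (Δ ^ 2 / ‖x‖ ^ 2) * perpVec x i * perpVec x j

/-- Squared Frobenius norm of a matrix. -/
def frob2 {m n : Type*} [Fintype m] [Fintype n] (A : Matrix m n ℝ) : ℝ :=
  ∑ i, ∑ j, (A i j) ^ 2

/-- `|D²y|²`: the sum of the squared Frobenius norms of the Hessians of the components. -/
def hessNormSq (y : E2 → E3) (x : E2) : ℝ :=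
  ∑ i : Fin 3, frob2 (hess (fun z => y z i) x)

/-- The free elastic energy `I_{h,Δ}(y)`. -/
def energy (h Δ : ℝ) (y : E2 → E3) : ℝ :=
  ∫ x in ball (0 : E2) 1, (frob2 (gmet y x - gDelta Δ x) + h ^ 2 * hessNormSq y x)

/-- The singular cone `y^Δ(x) = √(1-Δ²)·(x,0) + Δ|x| e₃`. -/
def coneMap (Δ : ℝ) (x : E2) : E3 :=
  (WithLp.equiv 2 (Fin 3 → ℝ)).symm
    ![Real.sqrt (1 - Δ ^ 2) * x 0, Real.sqrt (1 - Δ ^ 2) * x 1, Δ * ‖x‖]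



lemma wirt (f f' : ℝ → ℝ) (hf : ∀ x, HasDerivAt f (f' x) x) (hf' : Continuous f')
    (hper : f (-π) = f π) (hmean : ∫ x in (-π)..π, f x = 0) :
    ∫ x in (-π)..π, f x ^ 2 ≤ ∫ x in (-π)..π, f' x ^ 2 := by
  have hab : -π < π := by linarith [pi_pos]
  have hfc : Continuous f := continuous_iff_continuousAt.2 fun x => (hf x).continuousAt
  have mem : ∀ g : ℝ → ℝ, Continuous g →
      MemLp (fun x => (g x : ℂ)) 2 (volume.restrict (Set.Ioc (-π) π)) := by
    intro g hg
    have hc : Continuous fun x => (g x : ℂ) := Complex.continuous_ofReal.comp hg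
    obtain ⟨C, hC⟩ := (isCompact_Icc (a := -π) (b := π)).exists_bound_of_continuousOn
      hc.continuousOn
    refine MemLp.of_bound hc.aestronglyMeasurable C ?_
    refine (ae_restrict_iff' measurableSet_Ioc).2 (ae_of_all _ fun x hx => hC x ⟨hx.1.le, hx.2⟩)
  have h1 := hasSum_sq_fourierCoeffOn hab (mem f hfc)
  have h2 := hasSum_sq_fourierCoeffOn hab (mem f' hf')
  have key := hasSum_le (fun n => ?_) h1 h2
  · simp only [Complex.norm_real, Real.norm_eq_abs, sq_abs, smul_eq_mul] at key
    have hp : 0 < (π - -π)⁻¹ := by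
      apply inv_pos.2; linarith
    exact le_of_mul_le_mul_left key hp
  · show ‖fourierCoeffOn hab (fun x => (f x : ℂ)) n‖ ^ 2 ≤
      ‖fourierCoeffOn hab (fun x => (f' x : ℂ)) n‖ ^ 2
    by_cases hn : n = 0
    · have : fourierCoeffOn hab (fun x => (f x : ℂ)) n = 0 := by
        rw [fourierCoeffOn_eq_integral, hn]
        simp only [neg_zero, fourier_zero, one_smul, intervalIntegral.integral_ofReal, hmean]
        simp
      rw [this, norm_zero, zero_pow two_ne_zero]; positivity
    · rw [fourierCoeffOn_of_hasDerivAt hab hn (f' := fun x => (f' x : ℂ))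
        (fun x _ => (hf x).ofReal_comp)
        ((Complex.continuous_ofReal.comp hf').intervalIntegrable _ _)]
      rw [hper, sub_self, mul_zero, zero_sub]
      gcongr
      rw [norm_mul, norm_neg, norm_mul]
      have hn1 : (1:ℝ) ≤ |(n:ℝ)| := by
        exact_mod_cast Int.one_le_abs hn
      have e : ‖(1 / (-2 * π * Complex.I * n) : ℂ)‖ * ‖((π : ℂ) - ((-π : ℝ) : ℂ))‖ = 1 / |(n:ℝ)| := by
        have : ((π : ℂ) - ((-π : ℝ) : ℂ)) = ((2 * π : ℝ) : ℂ) := by push_cast; ring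
        rw [this]
        simp only [norm_div, norm_mul, norm_one, Complex.norm_I, Complex.norm_real, norm_neg,
          Complex.norm_intCast, Complex.norm_ofNat, Real.norm_eq_abs, abs_of_pos pi_pos, Nat.abs_ofNat]
        have := pi_pos
        field_simp
      rw [← mul_assoc, e]
      apply mul_le_of_le_one_left (norm_nonneg _)
      rw [div_le_one (by linarith)]; exact hn1

lemma circ (a b a' b' : ℝ → ℝ) (ha : ∀ x, HasDerivAt a (a' x) x) (ha' : Continuous a')
    (hb : ∀ x, HasDerivAt b (b' x) x) (hb' : Continuous b')
    (hpa : a (-π) = a π) (hpb : b (-π) = b π) :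
    ∫ x in (-π)..π, (a x * b' x - b x * a' x) ≤ ∫ x in (-π)..π, (a' x ^ 2 + b' x ^ 2) := by
  have hab : -π < π := by linarith [pi_pos]
  have hac : Continuous a := continuous_iff_continuousAt.2 fun x => (ha x).continuousAt
  have hbc : Continuous b := continuous_iff_continuousAt.2 fun x => (hb x).continuousAt
  obtain ⟨c, hc⟩ : ∃ c : ℝ, ∫ x in (-π)..π, (a x - c) = 0 := by
    refine ⟨(∫ x in (-π)..π, a x) / (2 * π), ?_⟩
    rw [intervalIntegral.integral_sub (hac.intervalIntegrable _ _) (by simp)]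
    simp only [intervalIntegral.integral_const, smul_eq_mul]
    have := pi_pos
    field_simp
    ring
  obtain ⟨d, hd⟩ : ∃ c : ℝ, ∫ x in (-π)..π, (b x - c) = 0 := by
    refine ⟨(∫ x in (-π)..π, b x) / (2 * π), ?_⟩
    rw [intervalIntegral.integral_sub (hbc.intervalIntegrable _ _) (by simp)]
    simp only [intervalIntegral.integral_const, smul_eq_mul]
    have := pi_pos
    field_simp
    ring
  have w1 := wirt (fun x => a x - c) a' (fun x => (ha x).sub_const c) ha' (by simp [hpa]) hc
  have w2 := wirt (fun x => b x - d) b' (fun x => (hb x).sub_const d) hb' (by simp [hpb]) hd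
  have ia : ∫ x in (-π)..π, a' x = 0 := by
    rw [intervalIntegral.integral_eq_sub_of_hasDerivAt (fun x _ => ha x)
      (ha'.intervalIntegrable _ _), hpa, sub_self]
  have ib : ∫ x in (-π)..π, b' x = 0 := by
    rw [intervalIntegral.integral_eq_sub_of_hasDerivAt (fun x _ => hb x)
      (hb'.intervalIntegrable _ _), hpb, sub_self]
  have step : ∫ x in (-π)..π, (a x * b' x - b x * a' x) ≤
      ∫ x in (-π)..π, ((1/2) * (a x - c)^2 + (1/2) * (b x - d)^2 + (1/2) * a' x ^ 2
        + (1/2) * b' x ^ 2 + c * b' x - d * a' x) := by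
    apply intervalIntegral.integral_mono_on hab.le
    · exact (Continuous.intervalIntegrable (by fun_prop) _ _)
    · exact (Continuous.intervalIntegrable (by fun_prop) _ _)
    · intro x _
      nlinarith [sq_nonneg (a x - c - b' x), sq_nonneg (b x - d + a' x)]
  refine step.trans ?_
  rw [intervalIntegral.integral_sub, intervalIntegral.integral_add, intervalIntegral.integral_add,
    intervalIntegral.integral_add, intervalIntegral.integral_add, intervalIntegral.integral_add]
  · simp only [intervalIntegral.integral_const_mul, ia, ib]
    linarith
  all_goals exact (Continuous.intervalIntegrable (by fun_prop) _ _)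

lemma polar_nonneg (F : E2 → ℝ)
    (H : ∀ r > 0, 0 ≤ ∫ θ in (-π)..π, F !₂[r * cos θ, r * sin θ]) : 0 ≤ ∫ x, F x := by
  have e1 : ∫ x, F x = ∫ p : ℝ × ℝ, F !₂[p.1, p.2] := by
    have m1 := (PiLp.volume_preserving_toLp (Fin 2))
    have m2 := ((volume_preserving_finTwoArrow ℝ).symm _)
    rw [← m1.integral_comp (MeasurableEquiv.toLp 2 (Fin 2 → ℝ)).measurableEmbedding,
      ← m2.integral_comp (MeasurableEquiv.measurableEmbedding _)]
    rfl
  rw [e1, ← integral_comp_polarCoord_symm, polarCoord_target]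
  set G : ℝ × ℝ → ℝ := fun p =>
    p.1 • F !₂[(polarCoord.symm p).1, (polarCoord.symm p).2] with hG
  show 0 ≤ ∫ p in _, G p
  by_cases hI : IntegrableOn G (Set.Ioi (0:ℝ) ×ˢ Set.Ioo (-π) π) (volume.prod volume)
  · rw [Measure.volume_eq_prod, setIntegral_prod _ hI]
    apply setIntegral_nonneg measurableSet_Ioi
    intro r hr
    have := H r hr
    rw [intervalIntegral.integral_of_le (by linarith [pi_pos]), integral_Ioc_eq_integral_Ioo] at this
    simp only [hG, polarCoord_symm_apply, smul_eq_mul]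
    rw [integral_const_mul]
    exact mul_nonneg (le_of_lt hr) this
  · rw [Measure.volume_eq_prod, integral_undef hI]

/-- squared radius -/
def sq2 (x : E2) : ℝ := x 0 ^ 2 + x 1 ^ 2
/-- radial weight -/
def Wf (h s : ℝ) : ℝ := (max 0 (1 - s)) ^ 2 / (s + h ^ 2)
/-- derivative of the weight -/
def Wd (h s : ℝ) : ℝ := -2 * max 0 (1 - s) / (s + h ^ 2) - (max 0 (1 - s)) ^ 2 / (s + h ^ 2) ^ 2
/-- angular derivative -/
def dth (f : E2 → ℝ) (x : E2) : ℝ := -x 1 * pd 0 f x + x 0 * pd 1 f x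
/-- the cross product term -/
def crs (u : E2 → ℝ) (x : E2) : ℝ := pd 0 u x * dth (pd 1 u) x - pd 1 u x * dth (pd 0 u) x

lemma sq2_nonneg (x : E2) : 0 ≤ sq2 x := by unfold sq2; positivity

lemma sq2_eq (x : E2) : sq2 x = ‖x‖ ^ 2 := by
  rw [EuclideanSpace.norm_sq_eq]; simp [sq2]

lemma mem_ball_iff (x : E2) : x ∈ ball (0 : E2) 1 ↔ sq2 x < 1 := by
  rw [mem_ball_zero_iff, sq2_eq]
  constructor
  · intro h; nlinarith [norm_nonneg x]
  · intro h; nlinarith [norm_nonneg x]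

lemma pd_contDiff {u : E2 → ℝ} {n m : WithTop ℕ∞} (hu : ContDiff ℝ n u) (hmn : m + 1 ≤ n) (j : Fin 2) :
    ContDiff ℝ m (pd j u) := by
  unfold pd
  exact (hu.fderiv_right hmn).clm_apply contDiff_const

lemma pd_cont {u : E2 → ℝ} (hu : ContDiff ℝ 1 u) (j : Fin 2) : Continuous (pd j u) :=
  (pd_contDiff (m := 0) hu (by simp) j).continuous

lemma fderiv_pd_eq (f : E2 → ℝ) (x v : E2) : fderiv ℝ f x v = v 0 * pd 0 f x + v 1 * pd 1 f x := by
  have : v = v 0 • e2 0 + v 1 • e2 1 := by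
    ext i; fin_cases i <;> simp [e2]
  conv_lhs => rw [this]
  simp [pd]

lemma pd_symm {u : E2 → ℝ} (hu : ContDiff ℝ 2 u) (i j : Fin 2) (x : E2) :
    pd i (pd j u) x = pd j (pd i u) x := by
  have hs : IsSymmSndFDerivAt ℝ u x := hu.contDiffAt.isSymmSndFDerivAt (by simp)
  have hd : DifferentiableAt ℝ (fderiv ℝ u) x :=
    ((hu.fderiv_right (m := 1) (by norm_num)).differentiable (by simp)) x
  have key : ∀ i j, pd i (pd j u) x = fderiv ℝ (fderiv ℝ u) x (e2 i) (e2 j) := by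
    intro i j
    show fderiv ℝ (fun z => fderiv ℝ u z (e2 j)) x (e2 i) = _
    rw [fderiv_clm_apply hd (by simp)]
    simp
  rw [key, key]
  exact hs _ _

lemma curve_deriv (r θ : ℝ) :
    HasDerivAt (fun t => (!₂[r * cos t, r * sin t] : E2)) !₂[-(r * sin θ), r * cos θ] θ := by
  have h := ((((Real.hasDerivAt_cos θ).const_mul r).smul_const (e2 0)).add
    (((Real.hasDerivAt_sin θ).const_mul r).smul_const (e2 1)))
  convert! h using 1
  · funext t; ext i; fin_cases i <;> simp [e2]
  · ext i; fin_cases i <;> simp [e2]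

lemma curve_cont (r : ℝ) : Continuous (fun t => (!₂[r * cos t, r * sin t] : E2)) :=
  continuous_iff_continuousAt.2 fun θ => (curve_deriv r θ).continuousAt

lemma comp_curve {f : E2 → ℝ} (hf : ContDiff ℝ 1 f) (r θ : ℝ) :
    HasDerivAt (fun t => f !₂[r * cos t, r * sin t]) (dth f !₂[r * cos θ, r * sin θ]) θ := by
  have h1 := (hf.differentiable (by simp) (!₂[r * cos θ, r * sin θ] : E2)).hasFDerivAt
  have := h1.comp_hasDerivAt θ (curve_deriv r θ)
  rw [fderiv_pd_eq] at this
  convert! this using 1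

lemma dth_cont {f : E2 → ℝ} (hf : ContDiff ℝ 1 f) : Continuous (dth f) := by
  unfold dth
  have h0 := pd_cont hf 0
  have h1 := pd_cont hf 1
  fun_prop

lemma Wf_nonneg {h s : ℝ} (hs : 0 ≤ s) : 0 ≤ Wf h s := by unfold Wf; positivity

lemma Wf_mul_le {h s : ℝ} (hh : 0 < h) (hs : 0 ≤ s) : Wf h s * s ≤ 1 := by
  unfold Wf
  have hp : 0 < s + h ^ 2 := by positivity
  rw [div_mul_eq_mul_div, div_le_one hp]
  have h0 : 0 ≤ max 0 (1 - s) := le_max_left _ _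
  have h1 : max 0 (1 - s) ≤ 1 := max_le (by norm_num) (by linarith)
  have : (max 0 (1 - s)) ^ 2 ≤ 1 := by nlinarith
  nlinarith [sq_nonneg h]

lemma Wf_zero {h s : ℝ} (hs : 1 ≤ s) : Wf h s = 0 := by
  unfold Wf; rw [max_eq_left (by linarith)]; simp

lemma hess_cont {u : E2 → ℝ} (hu : ContDiff ℝ 2 u) : Continuous fun x => frob2 (hess u x) := by
  have h := fun i j => pd_cont (pd_contDiff (m := 1) hu (by norm_num) j) i
  simp only [frob2, hess, Fin.sum_univ_two, Matrix.of_apply]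
  have h00 := h 0 0
  have h01 := h 0 1
  have h10 := h 1 0
  have h11 := h 1 1
  fun_prop

lemma dth_le (u : E2 → ℝ) (x : E2) :
    dth (pd 0 u) x ^ 2 + dth (pd 1 u) x ^ 2 ≤ sq2 x * frob2 (hess u x) := by
  simp only [frob2, hess, Fin.sum_univ_two, Matrix.of_apply, dth, sq2]
  nlinarith [sq_nonneg (x 0 * pd 0 (pd 0 u) x + x 1 * pd 1 (pd 0 u) x),
    sq_nonneg (x 0 * pd 0 (pd 1 u) x + x 1 * pd 1 (pd 1 u) x)]

lemma stepA {u : E2 → ℝ} (hu : ContDiff ℝ 2 u) {h : ℝ} (hh : 0 < h) :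
    0 ≤ ∫ x, ((ball (0 : E2) 1).indicator (fun x => frob2 (hess u x)) x
      - Wf h (sq2 x) * crs u x) := by
  apply polar_nonneg
  intro r hr
  have hsq : ∀ θ, sq2 !₂[r * cos θ, r * sin θ] = r ^ 2 := by
    intro θ; simp only [sq2]; simp; nlinarith [Real.sin_sq_add_cos_sq θ]
  by_cases h1 : r ^ 2 < 1
  · have hc0 : ContDiff ℝ 1 (pd 0 u) := pd_contDiff hu (by norm_num) 0
    have hc1 : ContDiff ℝ 1 (pd 1 u) := pd_contDiff hu (by norm_num) 1
    have key := circ (fun t => pd 0 u !₂[r * cos t, r * sin t])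
      (fun t => pd 1 u !₂[r * cos t, r * sin t])
      (fun t => dth (pd 0 u) !₂[r * cos t, r * sin t])
      (fun t => dth (pd 1 u) !₂[r * cos t, r * sin t])
      (fun t => comp_curve hc0 r t) ((dth_cont hc0).comp (curve_cont r))
      (fun t => comp_curve hc1 r t) ((dth_cont hc1).comp (curve_cont r)) (by simp) (by simp)
    have hle : -π ≤ π := by linarith [pi_pos]
    have i1 : Continuous fun t => frob2 (hess u !₂[r * cos t, r * sin t]) :=
      (hess_cont hu).comp (curve_cont r)
    have d0 : Continuous fun t => dth (pd 0 u) !₂[r * cos t, r * sin t] :=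
      (dth_cont hc0).comp (curve_cont r)
    have d1 : Continuous fun t => dth (pd 1 u) !₂[r * cos t, r * sin t] :=
      (dth_cont hc1).comp (curve_cont r)
    have p0 : Continuous fun t => pd 0 u !₂[r * cos t, r * sin t] :=
      hc0.continuous.comp (curve_cont r)
    have p1 : Continuous fun t => pd 1 u !₂[r * cos t, r * sin t] :=
      hc1.continuous.comp (curve_cont r)
    have k2 : ∫ θ in (-π)..π, (dth (pd 0 u) !₂[r * cos θ, r * sin θ] ^ 2 +
        dth (pd 1 u) !₂[r * cos θ, r * sin θ] ^ 2) ≤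
        ∫ θ in (-π)..π, r ^ 2 * frob2 (hess u !₂[r * cos θ, r * sin θ]) := by
      apply intervalIntegral.integral_mono_on hle
      · exact (Continuous.intervalIntegrable (by fun_prop) _ _)
      · exact (Continuous.intervalIntegrable (by fun_prop) _ _)
      · intro θ _
        have := dth_le u !₂[r * cos θ, r * sin θ]
        rwa [hsq] at this
    have e : ∀ θ, ((ball (0 : E2) 1).indicator (fun x => frob2 (hess u x)) !₂[r * cos θ, r * sin θ]
        - Wf h (sq2 !₂[r * cos θ, r * sin θ]) * crs u !₂[r * cos θ, r * sin θ]) =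
        frob2 (hess u !₂[r * cos θ, r * sin θ]) -
        Wf h (r ^ 2) * crs u !₂[r * cos θ, r * sin θ] := by
      intro θ
      rw [Set.indicator_of_mem, hsq]
      rw [mem_ball_iff, hsq]; exact h1
    simp only [e]
    unfold crs
    rw [intervalIntegral.integral_sub (i1.intervalIntegrable _ _)
      (Continuous.intervalIntegrable (by fun_prop) _ _), intervalIntegral.integral_const_mul]
    rw [intervalIntegral.integral_const_mul] at k2
    have hw := Wf_nonneg (h := h) (sq_nonneg r)
    have hw2 := Wf_mul_le hh (sq_nonneg r)
    have hpos : 0 ≤ ∫ θ in (-π)..π, frob2 (hess u !₂[r * cos θ, r * sin θ]) := by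
      apply intervalIntegral.integral_nonneg hle
      intro θ _
      unfold frob2; positivity
    have k3 := mul_le_mul_of_nonneg_left (key.trans k2) hw
    nlinarith [mul_le_mul_of_nonneg_right hw2 hpos]
  · have e : ∀ θ, ((ball (0 : E2) 1).indicator (fun x => frob2 (hess u x)) !₂[r * cos θ, r * sin θ]
        - Wf h (sq2 !₂[r * cos θ, r * sin θ]) * crs u !₂[r * cos θ, r * sin θ]) = 0 := by
      intro θ
      rw [Set.indicator_of_notMem, hsq, Wf_zero (not_lt.1 h1)]
      · ring
      · rw [mem_ball_iff, hsq]; exact h1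
    simp only [e]
    simp

lemma ibp {f G : E2 → ℝ} (hf : ContDiff ℝ 1 f) (hG : ContDiff ℝ 1 G) (hs : HasCompactSupport G)
    (k : Fin 2) : ∫ x, G x * pd k f x = - ∫ x, pd k G x * f x := by
  have hsp : HasCompactSupport (pd k G) := hs.fderiv_apply ℝ (e2 k)
  apply integral_mul_fderiv_eq_neg_fderiv_mul_of_integrable
  · exact ((pd_cont hG k).mul hf.continuous).integrable_of_hasCompactSupport hsp.mul_right
  · exact (hG.continuous.mul (pd_cont hf k)).integrable_of_hasCompactSupport hs.mul_right
  · exact (hG.continuous.mul hf.continuous).integrable_of_hasCompactSupport hs.mul_right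
  · exact fun x _ => hG.differentiable (by simp) x
  · exact fun x _ => hf.differentiable (by simp) x

lemma max_deriv (t : ℝ) : HasDerivAt (fun t : ℝ => (max 0 t) ^ 2) (2 * max 0 t) t := by
  rcases lt_trichotomy t 0 with h | h | h
  · rw [max_eq_left h.le, mul_zero]
    apply (hasDerivAt_const t (0:ℝ)).congr_of_eventuallyEq
    filter_upwards [gt_mem_nhds h] with z hz
    rw [max_eq_left hz.le]; simp
  · subst h
    simp only [max_self, mul_zero]
    rw [hasDerivAt_iff_isLittleO_nhds_zero]
    simp only [zero_add, max_self, smul_zero, sub_zero]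
    refine Asymptotics.IsBigO.trans_isLittleO (g := fun z : ℝ => z ^ 2) ?_ ?_
    · refine Asymptotics.IsBigO.of_bound 1 (Eventually.of_forall fun z => ?_)
      rw [one_mul, zero_pow two_ne_zero, sub_zero, norm_pow, norm_pow]
      have : ‖max 0 z‖ ≤ ‖z‖ := by
        rw [Real.norm_eq_abs, Real.norm_eq_abs, abs_of_nonneg (le_max_left _ _)]
        exact max_le (abs_nonneg _) (le_abs_self _)
      simpa using pow_le_pow_left₀ (norm_nonneg _) this 2
    · exact Asymptotics.isLittleO_pow_id (by norm_num)
  · rw [max_eq_right h.le]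
    have := hasDerivAt_pow 2 t
    simp only [Nat.cast_ofNat, Nat.add_one_sub_one, pow_one] at this
    apply this.congr_of_eventuallyEq
    filter_upwards [lt_mem_nhds h] with z hz
    rw [max_eq_right hz.le]

lemma max_C1 : ContDiff ℝ 1 (fun t : ℝ => (max 0 t) ^ 2) := by
  rw [contDiff_one_iff_deriv]
  refine ⟨fun t => (max_deriv t).differentiableAt, ?_⟩
  have : deriv (fun t : ℝ => (max 0 t) ^ 2) = fun t => 2 * max 0 t :=
    funext fun t => (max_deriv t).deriv
  rw [this]; fun_prop

lemma Wf_deriv {h s : ℝ} (hh : 0 < h) (hs : 0 ≤ s) : HasDerivAt (Wf h) (Wd h s) s := by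
  have hp : s + h ^ 2 ≠ 0 := by positivity
  have h1 : HasDerivAt (fun s : ℝ => (max 0 (1 - s)) ^ 2) (2 * max 0 (1 - s) * (-1)) s :=
    (max_deriv (1 - s)).comp s ((hasDerivAt_id s).const_sub 1)
  have h2 := h1.div ((hasDerivAt_id s).add_const (h ^ 2)) hp
  convert! h2 using 1
  unfold Wd
  simp only [id]
  field_simp

lemma coord_C1 {n : WithTop ℕ∞} (i : Fin 2) : ContDiff ℝ n (fun x : E2 => x i) :=
  (EuclideanSpace.proj i : E2 →L[ℝ] ℝ).contDiff

lemma sq2_C1 : ContDiff ℝ 1 sq2 := by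
  unfold sq2
  exact ((coord_C1 0).pow 2).add ((coord_C1 1).pow 2)

lemma w_C1 {h : ℝ} (hh : 0 < h) : ContDiff ℝ 1 (fun x => Wf h (sq2 x)) := by
  unfold Wf
  apply ContDiff.div
  · exact max_C1.comp (contDiff_const.sub sq2_C1)
  · exact sq2_C1.add contDiff_const
  · intro x
    have := sq2_nonneg x
    positivity

lemma wx_C1 {h : ℝ} (hh : 0 < h) (l : Fin 2) : ContDiff ℝ 1 (fun x => Wf h (sq2 x) * x l) :=
  (w_C1 hh).mul (coord_C1 l)

lemma w_supp (h : ℝ) : HasCompactSupport (fun x => Wf h (sq2 x)) := by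
  apply HasCompactSupport.of_support_subset_isCompact (isCompact_closedBall (0 : E2) 1)
  intro x hx
  by_contra hc
  apply hx
  apply Wf_zero
  by_contra h2
  exact hc (ball_subset_closedBall ((mem_ball_iff x).2 (not_le.1 h2)))

lemma wx_supp (h : ℝ) (l : Fin 2) : HasCompactSupport (fun x => Wf h (sq2 x) * x l) :=
  (w_supp h).mul_right

lemma pd_wx {h : ℝ} (hh : 0 < h) (k l : Fin 2) (x : E2) :
    pd k (fun x => Wf h (sq2 x) * x l) x =
      (if k = l then Wf h (sq2 x) else 0) + 2 * Wd h (sq2 x) * x k * x l := by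
  have hp : ∀ i : Fin 2, HasFDerivAt (fun x : E2 => x i)
      (EuclideanSpace.proj i : E2 →L[ℝ] ℝ) x := fun i =>
    (EuclideanSpace.proj i : E2 →L[ℝ] ℝ).hasFDerivAt
  have hs : HasFDerivAt sq2 _ x := ((hp 0).pow 2).add ((hp 1).pow 2)
  have hw := (Wf_deriv hh (sq2_nonneg x)).comp_hasFDerivAt x hs
  have := hw.mul (hp l)
  unfold pd
  rw [HasFDerivAt.fderiv (f := fun x => Wf h (sq2 x) * x l) this]
  fin_cases k <;> fin_cases l <;> simp [e2] <;> ring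

lemma gmet_eq (y : E2 → E3) (i j : Fin 2) (x : E2) :
    gmet y x i j = ∑ l : Fin 3, pd i (fun z => y z l) x * pd j (fun z => y z l) x := by
  simp [gmet, Dmat, Matrix.mul_apply]

lemma comp_C2 {y : E2 → E3} (hy : ContDiff ℝ 2 y) (l : Fin 3) : ContDiff ℝ 2 (fun z => y z l) :=
  (EuclideanSpace.proj l : E3 →L[ℝ] ℝ).contDiff.comp hy

lemma gmet_C1 {y : E2 → E3} (hy : ContDiff ℝ 2 y) (i j : Fin 2) :
    ContDiff ℝ 1 (fun x => gmet y x i j) := by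
  simp only [gmet_eq]
  apply ContDiff.sum
  intro l _
  exact (pd_contDiff (comp_C2 hy l) (by norm_num) i).mul (pd_contDiff (comp_C2 hy l) (by norm_num) j)

lemma pd_gmet {y : E2 → E3} (hy : ContDiff ℝ 2 y) (k i j : Fin 2) (x : E2) :
    pd k (fun x => gmet y x i j) x = ∑ l : Fin 3,
      (pd i (fun z => y z l) x * pd k (pd j (fun z => y z l)) x
      + pd j (fun z => y z l) x * pd k (pd i (fun z => y z l)) x) := by
  simp only [gmet_eq]
  have hd : ∀ (l : Fin 3) (i : Fin 2), DifferentiableAt ℝ (pd i (fun z => y z l)) x := fun l i =>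
    (pd_contDiff (m := 1) (comp_C2 hy l) (by norm_num) i).differentiable (by simp) x
  have := HasFDerivAt.fun_sum (u := Finset.univ) fun (l : Fin 3) _ =>
    (hd l i).hasFDerivAt.mul (hd l j).hasFDerivAt
  conv_lhs => unfold pd
  erw [HasFDerivAt.fderiv this]
  simp [pd]

lemma crs_sum {y : E2 → E3} (hy : ContDiff ℝ 2 y) (x : E2) :
    ∑ l : Fin 3, crs (fun z => y z l) x =
      -x 1 * (pd 1 (fun x => gmet y x 0 0) x - pd 0 (fun x => gmet y x 0 1) x)
      + x 0 * (pd 1 (fun x => gmet y x 0 1) x - pd 0 (fun x => gmet y x 1 1) x) := by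
  simp only [pd_gmet hy, crs, dth, Fin.sum_univ_three]
  rw [pd_symm (comp_C2 hy 0) 1 0, pd_symm (comp_C2 hy 1) 1 0, pd_symm (comp_C2 hy 2) 1 0]
  ring

/-- the metric tested against the cofactor matrix -/
def Qf (h : ℝ) (y : E2 → E3) (x : E2) : ℝ :=
  gmet y x 0 0 * (Wf h (sq2 x) + 2 * Wd h (sq2 x) * x 1 ^ 2)
  + 2 * gmet y x 0 1 * (-2 * Wd h (sq2 x) * x 0 * x 1)
  + gmet y x 1 1 * (Wf h (sq2 x) + 2 * Wd h (sq2 x) * x 0 ^ 2)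

lemma int1 {f G : E2 → ℝ} (hf : ContDiff ℝ 1 f) (hG : ContDiff ℝ 1 G) (hs : HasCompactSupport G)
    (k : Fin 2) : Integrable (fun x => G x * pd k f x) :=
  (hG.continuous.mul (pd_cont hf k)).integrable_of_hasCompactSupport hs.mul_right

lemma int2 {f G : E2 → ℝ} (hf : ContDiff ℝ 1 f) (hG : ContDiff ℝ 1 G) (hs : HasCompactSupport G)
    (k : Fin 2) : Integrable (fun x => pd k G x * f x) :=
  ((pd_cont hG k).mul hf.continuous).integrable_of_hasCompactSupport
    (HasCompactSupport.mul_right (hs.fderiv_apply ℝ (e2 k)))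

lemma stepB {y : E2 → E3} (hy : ContDiff ℝ 2 y) {h : ℝ} (hh : 0 < h) :
    ∫ x, Wf h (sq2 x) * ∑ l : Fin 3, crs (fun z => y z l) x = ∫ x, Qf h y x := by
  have c := fun i j => gmet_C1 hy i j
  have w := fun l => wx_C1 hh l
  have s := fun l => wx_supp h l
  have e1 : ∀ x, Wf h (sq2 x) * ∑ l : Fin 3, crs (fun z => y z l) x =
      (Wf h (sq2 x) * x 1) * pd 0 (fun x => gmet y x 0 1) x
      + (Wf h (sq2 x) * x 0) * pd 1 (fun x => gmet y x 0 1) x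
      - (Wf h (sq2 x) * x 1) * pd 1 (fun x => gmet y x 0 0) x
      - (Wf h (sq2 x) * x 0) * pd 0 (fun x => gmet y x 1 1) x := by
    intro x; rw [crs_sum hy]; ring
  have e2 : ∀ x, Qf h y x =
      pd 1 (fun x => Wf h (sq2 x) * x 1) x * gmet y x 0 0
      + pd 0 (fun x => Wf h (sq2 x) * x 0) x * gmet y x 1 1
      - pd 0 (fun x => Wf h (sq2 x) * x 1) x * gmet y x 0 1
      - pd 1 (fun x => Wf h (sq2 x) * x 0) x * gmet y x 0 1 := by
    intro x; simp only [pd_wx hh, Qf]; simp; ring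
  simp only [e1, e2]
  rw [integral_sub, integral_sub, integral_add, integral_sub, integral_sub, integral_add]
  · rw [ibp (c 0 1) (w 1) (s 1), ibp (c 0 1) (w 0) (s 0), ibp (c 0 0) (w 1) (s 1),
      ibp (c 1 1) (w 0) (s 0)]
    ring
  · exact int2 (c 0 0) (w 1) (s 1) 1
  · exact int2 (c 1 1) (w 0) (s 0) 0
  · exact (int2 (c 0 0) (w 1) (s 1) 1).add (int2 (c 1 1) (w 0) (s 0) 0)
  · exact int2 (c 0 1) (w 1) (s 1) 0
  · exact ((int2 (c 0 0) (w 1) (s 1) 1).add (int2 (c 1 1) (w 0) (s 0) 0)).sub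
      (int2 (c 0 1) (w 1) (s 1) 0)
  · exact int2 (c 0 1) (w 0) (s 0) 1
  · exact int1 (c 0 1) (w 1) (s 1) 0
  · exact int1 (c 0 1) (w 0) (s 0) 1
  · exact (int1 (c 0 1) (w 1) (s 1) 0).add (int1 (c 0 1) (w 0) (s 0) 1)
  · exact int1 (c 0 0) (w 1) (s 1) 1
  · exact ((int1 (c 0 1) (w 1) (s 1) 0).add (int1 (c 0 1) (w 0) (s 0) 1)).sub
      (int1 (c 0 0) (w 1) (s 1) 1)
  · exact int1 (c 1 1) (w 0) (s 0) 0

/-- the radial lower bound density -/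
def Rf (h Δ s : ℝ) : ℝ :=
  (1 - Δ ^ 2) * (2 * Wf h s + 2 * s * Wd h s) + Δ ^ 2 * Wf h s - 31 * h ^ 2 / (s + h ^ 2) ^ 2

lemma M_bound {h s : ℝ} (hh : 0 < h) (hh1 : h < 1) (hs : 0 ≤ s) (hs1 : s < 1) :
    2 * Wf h s ^ 2 + 4 * Wf h s * Wd h s * s + 4 * (Wd h s * s) ^ 2 ≤ 122 / (s + h ^ 2) ^ 2 := by
  have hp : 0 < s + h ^ 2 := by positivity
  have hp2 : s + h ^ 2 ≤ 2 := by nlinarith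
  unfold Wf Wd
  rw [max_eq_right (by linarith)]
  set q := s + h ^ 2 with hq
  have hsq : s ≤ q := by nlinarith [sq_nonneg h]
  have e : 2 * ((1 - s) ^ 2 / q) ^ 2 + 4 * ((1 - s) ^ 2 / q) * (-2 * (1 - s) / q - (1 - s) ^ 2 / q ^ 2) * s
      + 4 * ((-2 * (1 - s) / q - (1 - s) ^ 2 / q ^ 2) * s) ^ 2 =
      (2 * (1 - s) ^ 4 - 4 * (1 - s) ^ 2 * (2 * (1 - s) * s + (1 - s) ^ 2 * (s / q))
       + 4 * (2 * (1 - s) * s + (1 - s) ^ 2 * (s / q)) ^ 2) / q ^ 2 := by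
    field_simp
    ring
  rw [e]
  gcongr
  have ht : s / q ≤ 1 := (div_le_one hp).2 hsq
  have ht0 : 0 ≤ s / q := by positivity
  set t := s / q
  have a0 : 0 ≤ 1 - s := by linarith
  have a1 : (1 - s) ^ 2 ≤ 1 := by nlinarith
  have b0 : 0 ≤ 2 * (1 - s) * s + (1 - s) ^ 2 * t := by positivity
  have b1 : 2 * (1 - s) * s + (1 - s) ^ 2 * t ≤ 3 := by nlinarith [sq_nonneg (1 - s)]
  have a4 : (1 - s) ^ 4 ≤ 1 := by
    have : (1 - s) ^ 4 = ((1 - s) ^ 2) ^ 2 := by ring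
    rw [this]; nlinarith [sq_nonneg (1 - s)]
  have : 0 ≤ (1 - s) ^ 2 * (2 * (1 - s) * s + (1 - s) ^ 2 * t) := by positivity
  nlinarith

lemma alg_fin (h R K a b c d e f A B C : ℝ) (h1 : R ≤ d * A + 2 * e * B + f * C)
    (h2 : A ^ 2 + 2 * B ^ 2 + C ^ 2 ≤ K) :
    h ^ 2 * (R - h ^ 2 / 4 * K) ≤ (a - d) ^ 2 + (b - e) ^ 2 + ((b - e) ^ 2 + (c - f) ^ 2)
      + h ^ 2 * (a * A + 2 * b * B + c * C) := by
  have k1 := mul_le_mul_of_nonneg_left h1 (sq_nonneg h)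
  have k2 := mul_le_mul_of_nonneg_left h2 (by positivity : 0 ≤ h ^ 2 * h ^ 2 / 4)
  have q1 := sq_nonneg (a - d + h ^ 2 / 2 * A)
  have q2 := sq_nonneg (b - e + h ^ 2 / 2 * B)
  have q3 := sq_nonneg (c - f + h ^ 2 / 2 * C)
  linarith

lemma pointwise {h Δ : ℝ} (hh : 0 < h) (hh1 : h < 1) (y : E2 → E3) (x : E2)
    (hx : sq2 x < 1) :
    h ^ 2 * Rf h Δ (sq2 x) ≤ frob2 (gmet y x - gDelta Δ x) + h ^ 2 * Qf h y x := by
  have hs := sq2_nonneg x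
  have hM := M_bound hh hh1 hs hx
  have hsym : gmet y x 1 0 = gmet y x 0 1 := by
    rw [gmet_eq, gmet_eq]; simp only [mul_comm]
  have hW := Wf_nonneg (h := h) hs
  simp only [frob2, Fin.sum_univ_two, Matrix.sub_apply, Qf, hsym]
  -- entries of the reference metric
  have hdef : ∀ i j, gDelta Δ x i j = (if i = j then 1 else 0)
      - (Δ ^ 2 / sq2 x) * perpVec x i * perpVec x j := by
    intro i j
    simp only [gDelta, Matrix.sub_apply, Matrix.of_apply, Matrix.one_apply, sq2_eq]
  have d00 : gDelta Δ x 0 0 = 1 - (Δ ^ 2 / sq2 x) * x 1 ^ 2 := by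
    rw [hdef]; simp [perpVec]; ring
  have d01 : gDelta Δ x 0 1 = (Δ ^ 2 / sq2 x) * (x 0 * x 1) := by
    rw [hdef]; simp [perpVec]; ring
  have d10 : gDelta Δ x 1 0 = (Δ ^ 2 / sq2 x) * (x 0 * x 1) := by
    rw [hdef]; simp [perpVec]; ring
  have d11 : gDelta Δ x 1 1 = 1 - (Δ ^ 2 / sq2 x) * x 0 ^ 2 := by
    rw [hdef]; simp [perpVec]; ring
  set W := Wf h (sq2 x) with hWdef
  set V := Wd h (sq2 x) with hVdef
  have href : (1 - Δ ^ 2) * (2 * W + 2 * sq2 x * V) + Δ ^ 2 * W ≤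
      gDelta Δ x 0 0 * (W + 2 * V * x 1 ^ 2) + 2 * gDelta Δ x 0 1 * (-2 * V * x 0 * x 1)
      + gDelta Δ x 1 1 * (W + 2 * V * x 0 ^ 2) := by
    rw [d00, d01, d11]
    by_cases h0 : sq2 x = 0
    · have hx0 : x 0 = 0 := by
        unfold sq2 at h0; nlinarith [sq_nonneg (x 0), sq_nonneg (x 1)]
      have hx1 : x 1 = 0 := by
        unfold sq2 at h0; nlinarith [sq_nonneg (x 0), sq_nonneg (x 1)]
      rw [h0, hx0, hx1]
      nlinarith [sq_nonneg Δ, mul_nonneg (sq_nonneg Δ) hW]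
    · apply le_of_eq
      have : ∀ c : ℝ, (1 - c * x 1 ^ 2) * (W + 2 * V * x 1 ^ 2)
          + 2 * (c * (x 0 * x 1)) * (-2 * V * x 0 * x 1)
          + (1 - c * x 0 ^ 2) * (W + 2 * V * x 0 ^ 2) =
          2 * W + 2 * V * sq2 x - (c * sq2 x) * (W + 2 * V * sq2 x) := by
        intro c; unfold sq2; ring
      rw [this, div_mul_cancel₀ _ h0]
      ring
  have hMM : (W + 2 * V * x 1 ^ 2) ^ 2 + 2 * (-2 * V * x 0 * x 1) ^ 2 + (W + 2 * V * x 0 ^ 2) ^ 2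
      = 2 * W ^ 2 + 4 * W * V * sq2 x + 4 * (V * sq2 x) ^ 2 := by
    unfold sq2; ring
  rw [← hMM] at hM
  rw [d10, ← d01]
  have hR : Rf h Δ (sq2 x) = (1 - Δ ^ 2) * (2 * W + 2 * sq2 x * V) + Δ ^ 2 * W
      - h ^ 2 / 4 * (124 / (sq2 x + h ^ 2) ^ 2) := by
    unfold Rf; ring
  rw [hR]
  have h124 : 122 / (sq2 x + h ^ 2) ^ 2 ≤ 124 / (sq2 x + h ^ 2) ^ 2 := by gcongr; norm_num
  have hM2 := hM.trans h124
  exact alg_fin _ _ _ _ _ _ _ _ _ _ _ _ href hM2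

lemma Wd_cont {h : ℝ} (hh : 0 < h) : ContinuousOn (Wd h) (Set.Ici 0) := by
  unfold Wd
  refine ContinuousOn.sub (ContinuousOn.div (by fun_prop) (by fun_prop) ?_)
    (ContinuousOn.div (by fun_prop) (by fun_prop) ?_) <;>
  · intro s hs
    have : 0 ≤ s := hs
    positivity

lemma Rf_cont {h : ℝ} (hh : 0 < h) (Δ : ℝ) : ContinuousOn (Rf h Δ) (Set.Ici 0) := by
  unfold Rf
  have h1 := Wd_cont hh
  have h2 : ContinuousOn (Wf h) (Set.Ici 0) := fun s hs =>
    (Wf_deriv hh hs).continuousAt.continuousWithinAt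
  have h3 : ContinuousOn (fun s : ℝ => 31 * h ^ 2 / (s + h ^ 2) ^ 2) (Set.Ici 0) := by
    refine ContinuousOn.div (by fun_prop) (by fun_prop) ?_
    intro s hs
    have : 0 ≤ s := hs
    positivity
  fun_prop

lemma radial {h Δ : ℝ} (hh : 0 < h) (hh1 : h < 1) (hΔ : 0 < Δ) (hΔ1 : Δ < 1) :
    2 * π * (Δ ^ 2 * (log (1 / h) - 1) - 31 / 2) ≤ ∫ x in ball (0 : E2) 1, Rf h Δ (sq2 x) := by
  have e : ∫ x in ball (0 : E2) 1, Rf h Δ (sq2 x) =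
      ∫ x : E2, (fun r : ℝ => (Set.Iio (1:ℝ)).indicator (fun r => Rf h Δ (r ^ 2)) r) ‖x‖ := by
    rw [← integral_indicator measurableSet_ball]
    congr 1
    funext x
    by_cases hx : ‖x‖ < 1
    · rw [Set.indicator_of_mem (by simpa using hx)]
      simp only
      rw [Set.indicator_of_mem (by simpa using hx), sq2_eq]
    · rw [Set.indicator_of_notMem (by simpa using hx)]
      simp only
      rw [Set.indicator_of_notMem (by simpa using hx)]
  rw [e, integral_fun_norm_addHaar]
  have hvol : (volume : Measure E2).real (ball 0 1) = π := by
    rw [Measure.real, EuclideanSpace.volume_ball]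
    have : Real.Gamma (1 + 1) = 1 := by rw [one_add_one_eq_two, Real.Gamma_two]
    simp [Real.pi_nonneg, this]
  rw [hvol]
  simp only [finrank_euclideanSpace, Fintype.card_fin, Nat.add_one_sub_one, pow_one, smul_eq_mul,
    nsmul_eq_mul, Nat.cast_ofNat]
  rw [← mul_assoc]
  have hpi := pi_pos
  refine mul_le_mul_of_nonneg_left ?_ (by positivity)
  have e2 : ∫ r in Set.Ioi (0:ℝ), r * (Set.Iio (1:ℝ)).indicator (fun r => Rf h Δ (r ^ 2)) r =
      ∫ r in (0:ℝ)..1, r * Rf h Δ (r ^ 2) := by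
    rw [intervalIntegral.integral_of_le zero_le_one, integral_Ioc_eq_integral_Ioo]
    have : (fun r : ℝ => r * (Set.Iio (1:ℝ)).indicator (fun r => Rf h Δ (r ^ 2)) r) =
        (Set.Iio (1:ℝ)).indicator (fun r => r * Rf h Δ (r ^ 2)) := by
      funext r
      by_cases hr : r < 1
      · rw [Set.indicator_of_mem (by simpa using hr), Set.indicator_of_mem (by simpa using hr)]
      · rw [Set.indicator_of_notMem (by simpa using hr),
          Set.indicator_of_notMem (by simpa using hr), mul_zero]
    rw [this, setIntegral_indicator measurableSet_Iio, Set.Ioi_inter_Iio]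
  rw [e2]
  set A : ℝ → ℝ := fun r => (1 - Δ ^ 2) * (r ^ 2 * Wf h (r ^ 2))
    + Δ ^ 2 * (1 / 2 * log (r ^ 2 + h ^ 2) - r ^ 2) + 31 / 2 * h ^ 2 / (r ^ 2 + h ^ 2) with hA
  set A' : ℝ → ℝ := fun r => (1 - Δ ^ 2) * (2 * r * Wf h (r ^ 2) + r ^ 2 * (Wd h (r ^ 2) * (2 * r)))
    + Δ ^ 2 * (r / (r ^ 2 + h ^ 2) - 2 * r) - 31 * h ^ 2 * r / (r ^ 2 + h ^ 2) ^ 2 with hA'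
  have hder : ∀ r, HasDerivAt A (A' r) r := by
    intro r
    have hp : r ^ 2 + h ^ 2 ≠ 0 := by positivity
    have hr2 : HasDerivAt (fun r : ℝ => r ^ 2) (2 * r) r := by
      simpa using hasDerivAt_pow 2 r
    have hw : HasDerivAt (fun r => Wf h (r ^ 2)) (Wd h (r ^ 2) * (2 * r)) r :=
      HasDerivAt.comp (h₂ := Wf h) (h := fun r : ℝ => r ^ 2) r (Wf_deriv hh (sq_nonneg r)) hr2
    have hq : HasDerivAt (fun r : ℝ => r ^ 2 + h ^ 2) (2 * r) r := hr2.add_const _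
    have := (((hr2.mul hw).const_mul (1 - Δ ^ 2)).add
      ((((hq.log hp).const_mul (1 / 2)).sub hr2).const_mul (Δ ^ 2))).add
      ((hasDerivAt_const r (31 / 2 * h ^ 2)).div hq hp)
    convert! this using 1
    simp only [hA']
    field_simp
    ring
  have hcW : Continuous fun r : ℝ => Wf h (r ^ 2) := continuous_iff_continuousAt.2 fun r =>
    ContinuousAt.comp (f := fun r : ℝ => r ^ 2) (Wf_deriv hh (sq_nonneg r)).continuousAt
      (by fun_prop)
  have hcV : Continuous fun r : ℝ => Wd h (r ^ 2) := by
    have := (Wd_cont hh).comp_continuous (f := fun r : ℝ => r ^ 2) (by fun_prop)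
      (fun r => sq_nonneg r)
    exact this
  have hcR : Continuous fun r : ℝ => Rf h Δ (r ^ 2) := by
    have := (Rf_cont hh Δ).comp_continuous (f := fun r : ℝ => r ^ 2) (by fun_prop)
      (fun r => sq_nonneg r)
    exact this
  have hpne : ∀ r : ℝ, r ^ 2 + h ^ 2 ≠ 0 := fun r => by positivity
  have hcA' : Continuous A' := by
    have c1 : Continuous fun r : ℝ => r / (r ^ 2 + h ^ 2) := by
      exact continuous_id.div (by fun_prop) hpne
    have c2 : Continuous fun r : ℝ => 31 * h ^ 2 * r / (r ^ 2 + h ^ 2) ^ 2 := by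
      exact Continuous.div (by fun_prop) (by fun_prop) (fun r => pow_ne_zero 2 (hpne r))
    simp only [hA']
    fun_prop
  have hFTC := intervalIntegral.integral_eq_sub_of_hasDerivAt (a := 0) (b := 1)
    (fun r _ => hder r) (hcA'.intervalIntegrable _ _)
  have hmono : ∫ r in (0:ℝ)..1, A' r ≤ ∫ r in (0:ℝ)..1, r * Rf h Δ (r ^ 2) := by
    apply intervalIntegral.integral_mono_on zero_le_one (hcA'.intervalIntegrable _ _)
      (Continuous.intervalIntegrable (by fun_prop) _ _)
    intro r hr
    have hr0 := hr.1
    have hr1 : r ^ 2 ≤ 1 := by nlinarith [hr.2]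
    have hp : 0 < r ^ 2 + h ^ 2 := by positivity
    have key : r / (r ^ 2 + h ^ 2) - 2 * r ≤ r * Wf h (r ^ 2) := by
      unfold Wf
      rw [max_eq_right (by linarith), ← mul_div_assoc, sub_le_iff_le_add, div_le_iff₀ hp, add_mul,
        div_mul_cancel₀ _ hp.ne']
      nlinarith [mul_nonneg hr0 (sq_nonneg (r ^ 2)), mul_nonneg hr0 (sq_nonneg h)]
    have k2 := mul_le_mul_of_nonneg_left key (sq_nonneg Δ)
    simp only [hA', Rf]
    have e3 : 31 * h ^ 2 * r / (r ^ 2 + h ^ 2) ^ 2 = r * (31 * h ^ 2 / (r ^ 2 + h ^ 2) ^ 2) := by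
      ring
    rw [e3]
    linarith
  refine le_trans ?_ hmono
  rw [hFTC]
  have a1 : A 1 = Δ ^ 2 * (1 / 2 * log (1 + h ^ 2) - 1) + 31 / 2 * h ^ 2 / (1 + h ^ 2) := by
    simp only [hA, one_pow]; rw [Wf_zero le_rfl]; ring
  have a0 : A 0 = Δ ^ 2 * log h + 31 / 2 := by
    simp only [hA]
    have : (0:ℝ) ^ 2 = 0 := by norm_num
    rw [this, zero_add, Real.log_pow, mul_div_assoc, div_self (by positivity)]
    push_cast
    ring
  rw [a1, a0, one_div, Real.log_inv]
  have l1 : 0 ≤ log (1 + h ^ 2) := Real.log_nonneg (by nlinarith [sq_nonneg h])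
  have l2 : 0 ≤ 31 / 2 * h ^ 2 / (1 + h ^ 2) := by positivity
  nlinarith [mul_nonneg (sq_nonneg Δ) l1]

lemma intBall {f : E2 → ℝ} (hf : Continuous f) : IntegrableOn f (ball (0 : E2) 1) :=
  (hf.continuousOn.integrableOn_compact (isCompact_closedBall (0 : E2) 1)).mono_set
    ball_subset_closedBall

lemma gDelta_entry (Δ : ℝ) (x : E2) (i j : Fin 2) : gDelta Δ x i j = (if i = j then 1 else 0)
      - (Δ ^ 2 / sq2 x) * perpVec x i * perpVec x j := by
  simp only [gDelta, Matrix.sub_apply, Matrix.of_apply, Matrix.one_apply, sq2_eq]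

lemma sq2_cont : Continuous sq2 := sq2_C1.continuous

lemma perp_cont (i : Fin 2) : Continuous fun x => perpVec x i := by
  fin_cases i <;> simp [perpVec] <;> fun_prop

lemma gDelta_meas (Δ : ℝ) (i j : Fin 2) : Measurable fun x => gDelta Δ x i j := by
  simp only [gDelta_entry]
  exact measurable_const.sub (((measurable_const.div sq2_cont.measurable).mul
    (perp_cont i).measurable).mul (perp_cont j).measurable)

lemma gDelta_bd {Δ : ℝ} (h0 : 0 < Δ) (h1 : Δ < 1) (x : E2) (i j : Fin 2) :
    (gDelta Δ x i j) ^ 2 ≤ 4 := by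
  rw [gDelta_entry]
  have hb : |Δ ^ 2 / sq2 x * perpVec x i * perpVec x j| ≤ 1 := by
    have hs := sq2_nonneg x
    have hp : ∀ i, (perpVec x i) ^ 2 ≤ sq2 x := by
      intro i; fin_cases i <;> simp [perpVec, sq2] <;> positivity
    have hpp : |perpVec x i * perpVec x j| ≤ sq2 x := by
      rw [abs_le]
      constructor <;> nlinarith [hp i, hp j, sq_nonneg (perpVec x i + perpVec x j),
        sq_nonneg (perpVec x i - perpVec x j)]
    rw [mul_assoc, abs_mul, abs_of_nonneg (by positivity : 0 ≤ Δ ^ 2 / sq2 x)]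
    calc Δ ^ 2 / sq2 x * |perpVec x i * perpVec x j| ≤ Δ ^ 2 / sq2 x * sq2 x := by gcongr
      _ ≤ Δ ^ 2 := by
          rcases eq_or_ne (sq2 x) 0 with hz | hz
          · rw [hz, mul_zero]; positivity
          · rw [div_mul_cancel₀ _ hz]
      _ ≤ 1 := by nlinarith
  rw [abs_le] at hb
  obtain ⟨hb1, hb2⟩ := hb
  split_ifs <;> nlinarith

lemma frob_int {Δ : ℝ} (h0 : 0 < Δ) (h1 : Δ < 1) {y : E2 → E3} (hy : ContDiff ℝ 2 y) :
    IntegrableOn (fun x => frob2 (gmet y x - gDelta Δ x)) (ball (0 : E2) 1) := by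
  have hg := fun i j => (gmet_C1 hy i j).continuous
  have hbd : Continuous fun x => ∑ i : Fin 2, ∑ j : Fin 2, (2 * (gmet y x i j) ^ 2 + 8) := by
    fun_prop
  refine (intBall hbd).mono' ?_ ?_
  · apply Measurable.aestronglyMeasurable
    simp only [frob2, Matrix.sub_apply]
    refine Finset.measurable_sum _ fun i _ => Finset.measurable_sum _ fun j _ => ?_
    exact ((hg i j).measurable.sub (gDelta_meas Δ i j)).pow_const 2
  · refine ae_of_all _ fun x => ?_
    rw [Real.norm_of_nonneg (by unfold frob2; positivity)]
    simp only [frob2, Matrix.sub_apply]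
    refine Finset.sum_le_sum fun i _ => Finset.sum_le_sum fun j _ => ?_
    nlinarith [gDelta_bd h0 h1 x i j, sq_nonneg (gmet y x i j + gDelta Δ x i j)]

lemma crs_cont {u : E2 → ℝ} (hu : ContDiff ℝ 2 u) : Continuous (crs u) := by
  have hc0 : ContDiff ℝ 1 (pd 0 u) := pd_contDiff hu (by norm_num) 0
  have hc1 : ContDiff ℝ 1 (pd 1 u) := pd_contDiff hu (by norm_num) 1
  unfold crs
  exact (hc0.continuous.mul (dth_cont hc1)).sub (hc1.continuous.mul (dth_cont hc0))

lemma wcrs_int {u : E2 → ℝ} (hu : ContDiff ℝ 2 u) {h : ℝ} (hh : 0 < h) :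
    Integrable (fun x => Wf h (sq2 x) * crs u x) :=
  ((w_C1 hh).continuous.mul (crs_cont hu)).integrable_of_hasCompactSupport (w_supp h).mul_right

lemma stepA' {u : E2 → ℝ} (hu : ContDiff ℝ 2 u) {h : ℝ} (hh : 0 < h) :
    ∫ x, Wf h (sq2 x) * crs u x ≤ ∫ x in ball (0 : E2) 1, frob2 (hess u x) := by
  have := stepA hu hh
  rw [integral_sub ((intBall (hess_cont hu)).integrable_indicator measurableSet_ball)
    (wcrs_int hu hh), integral_indicator measurableSet_ball] at this
  linarith

lemma Wd_zero {h s : ℝ} (hs : 1 ≤ s) : Wd h s = 0 := by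
  unfold Wd; rw [max_eq_left (by linarith)]; simp

lemma Qf_cont {y : E2 → E3} (hy : ContDiff ℝ 2 y) {h : ℝ} (hh : 0 < h) : Continuous (Qf h y) := by
  have hg := fun i j => (gmet_C1 hy i j).continuous
  have hw := (w_C1 hh).continuous
  have hv : Continuous fun x => Wd h (sq2 x) :=
    (Wd_cont hh).comp_continuous sq2_cont (fun x => sq2_nonneg x)
  unfold Qf
  fun_prop

lemma main_bound {Δ h : ℝ} (h0 : 0 < Δ) (h1 : Δ < 1) (hh : 0 < h) (hh1 : h < 1) {y : E2 → E3}
    (hy : ContDiff ℝ 2 y) :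
    h ^ 2 * ∫ x in ball (0 : E2) 1, Rf h Δ (sq2 x) ≤ energy h Δ y := by
  have iF := frob_int h0 h1 hy
  have iH := fun l : Fin 3 => intBall (hess_cont (comp_C2 hy l))
  have iQ := intBall (Qf_cont hy hh)
  have iR : IntegrableOn (fun x => Rf h Δ (sq2 x)) (ball (0 : E2) 1) :=
    intBall ((Rf_cont hh Δ).comp_continuous sq2_cont (fun x => sq2_nonneg x))
  have hE : energy h Δ y = (∫ x in ball (0 : E2) 1, frob2 (gmet y x - gDelta Δ x))
      + h ^ 2 * ∑ l : Fin 3, ∫ x in ball (0 : E2) 1, frob2 (hess (fun z => y z l) x) := by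
    unfold energy hessNormSq
    rw [integral_add iF, integral_const_mul, integral_finsetSum]
    · exact fun l _ => iH l
    · exact (integrable_finsetSum _ fun l _ => iH l).const_mul _
  have hQ : ∫ x in ball (0 : E2) 1, Qf h y x ≤
      ∑ l : Fin 3, ∫ x in ball (0 : E2) 1, frob2 (hess (fun z => y z l) x) := by
    have e1 : ∫ x in ball (0 : E2) 1, Qf h y x = ∫ x, Qf h y x := by
      apply setIntegral_eq_integral_of_forall_compl_eq_zero
      intro x hx
      rw [mem_ball_iff, not_lt] at hx
      simp [Qf, Wf_zero hx, Wd_zero hx]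
    rw [e1, ← stepB hy hh]
    simp only [Finset.mul_sum]
    rw [integral_finsetSum _ fun l _ => wcrs_int (comp_C2 hy l) hh]
    exact Finset.sum_le_sum fun l _ => stepA' (comp_C2 hy l) hh
  have hfin : ∫ x in ball (0 : E2) 1, h ^ 2 * Rf h Δ (sq2 x) ≤
      ∫ x in ball (0 : E2) 1, (frob2 (gmet y x - gDelta Δ x) + h ^ 2 * Qf h y x) := by
    apply setIntegral_mono_on (iR.const_mul _) (iF.add (iQ.const_mul _)) measurableSet_ball
    intro x hx
    exact pointwise hh hh1 y x ((mem_ball_iff x).1 hx)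
  rw [integral_const_mul, integral_add iF (iQ.const_mul _), integral_const_mul] at hfin
  rw [hE]
  have := mul_le_mul_of_nonneg_left hQ (sq_nonneg h)
  linarith

/-- ansatz-free lower bound for the elastic energy. -/
theorem stmt_0 (Δ : ℝ) (hΔ0 : 0 < Δ) (hΔ1 : Δ < 1) :
    ∃ C₁ > (0 : ℝ), ∃ h₀ ∈ Set.Ioo (0 : ℝ) 1, ∀ h ∈ Set.Ioo (0 : ℝ) h₀,
      ∀ y : E2 → E3, ContDiff ℝ 2 y →
        2 * π * Δ ^ 2 * h ^ 2 * (Real.log (1 / h) - C₁) ≤ energy h Δ y := by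
  refine ⟨1 + 31 / 2 / Δ ^ 2, by positivity, 1 / 2, ⟨by norm_num, by norm_num⟩, ?_⟩
  intro h hh y hy
  have hh1 : h < 1 := by linarith [hh.2]
  refine le_trans (le_of_eq ?_) (main_bound hΔ0 hΔ1 hh.1 hh1 hy |>.trans' <|
    mul_le_mul_of_nonneg_left (radial hh.1 hh1 hΔ0 hΔ1) (sq_nonneg h))
  field_simp
  ring
end
end

section
/- Let 0<Δ<1. There exists a constant C₂>0 depending only on Δ such that for every sufficiently small h>0 there exists a map y ∈ C^∞(cl(B₁); ℝ³) with I_{h,Δ}(y) ≤ 2πΔ²h²(log(1/h) + C₂). Consequently inf_{y∈C²} I_{h,Δ}(y) ≤ 2πΔ²h²(log(1/h) + C₂). -/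
open MeasureTheory Metric Real Filter Matrix
open scoped ENNReal Topology

noncomputable section

/-- Regularised norm. -/
def rho (h : ℝ) (x : E2) : ℝ := Real.sqrt (‖x‖ ^ 2 + h ^ 2)

/-- The test deformation. -/
def ytest (h Δ : ℝ) (x : E2) : E3 :=
  WithLp.toLp 2 ![Real.sqrt (1 - Δ ^ 2) * x 0, Real.sqrt (1 - Δ ^ 2) * x 1, Δ * rho h x]

lemma s_pos {h : ℝ} (hh : 0 < h) (x : E2) : 0 < ‖x‖ ^ 2 + h ^ 2 := by positivity

lemma rho_pos {h : ℝ} (hh : 0 < h) (x : E2) : 0 < rho h x := Real.sqrt_pos.2 (s_pos hh x)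

lemma rho_sq {h : ℝ} (hh : 0 < h) (x : E2) : rho h x ^ 2 = ‖x‖ ^ 2 + h ^ 2 :=
  Real.sq_sqrt (s_pos hh x).le

lemma contDiff_rho {h : ℝ} (hh : 0 < h) : ContDiff ℝ (⊤ : ℕ∞) (rho h) := by
  unfold rho
  exact ((contDiff_norm_sq ℝ).add contDiff_const).sqrt (fun x => (s_pos hh x).ne')

lemma norm_sq_E2 (x : E2) : ‖x‖ ^ 2 = x 0 ^ 2 + x 1 ^ 2 := by
  rw [EuclideanSpace.real_norm_sq_eq]; simp [Fin.sum_univ_two]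

lemma hasFDerivAt_rho {h : ℝ} (hh : 0 < h) (x : E2) :
    HasFDerivAt (rho h) ((1 / rho h x) • innerSL ℝ x) x := by
  have h1 := ((hasStrictFDerivAt_norm_sq x).hasFDerivAt.add_const (h ^ 2)).sqrt (s_pos hh x).ne'
  refine h1.congr_fderiv ?_
  ext v
  simp [rho]
  field_simp

lemma hasFDerivAt_coord (j : Fin 2) (x : E2) :
    HasFDerivAt (fun z : E2 => z j) (EuclideanSpace.proj (𝕜 := ℝ) j : E2 →L[ℝ] ℝ) x :=
  (EuclideanSpace.proj (𝕜 := ℝ) j : E2 →L[ℝ] ℝ).hasFDerivAt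

lemma coord_e2 (i j : Fin 2) : (e2 i) j = if j = i then 1 else 0 := by
  simp [e2, Pi.single_apply]

lemma pd_coord (c : ℝ) (i j : Fin 2) (x : E2) :
    pd i (fun z => c * z j) x = c * (if j = i then 1 else 0) := by
  unfold pd
  rw [((hasFDerivAt_coord j x).const_mul c).fderiv]
  simp [coord_e2]

lemma pd_rho {h : ℝ} (hh : 0 < h) (Δ : ℝ) (j : Fin 2) (x : E2) :
    pd j (fun z => Δ * rho h z) x = Δ * (x j / rho h x) := by
  unfold pd
  rw [((hasFDerivAt_rho hh x).const_mul Δ).fderiv]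
  simp [e2, EuclideanSpace.inner_single_right]
  left
  ring

lemma pd_pd_rho {h : ℝ} (hh : 0 < h) (Δ : ℝ) (i j : Fin 2) (x : E2) :
    pd i (pd j (fun z => Δ * rho h z)) x =
      Δ * ((if j = i then 1 else 0) / rho h x - x i * x j / rho h x ^ 3) := by
  have e : pd j (fun z => Δ * rho h z) = fun z => Δ * (z j * (rho h z)⁻¹) := by
    funext z; rw [pd_rho hh, div_eq_mul_inv]
  rw [e]
  unfold pd
  have hr := (rho_pos hh x).ne'
  have h1 := ((hasFDerivAt_coord j x).mul
    ((hasDerivAt_inv hr).comp_hasFDerivAt x (hasFDerivAt_rho hh x))).const_mul Δ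
  have h2 : HasFDerivAt (fun z : E2 => Δ * (z j * (rho h z)⁻¹)) _ x := h1
  rw [h2.fderiv]
  have he : (EuclideanSpace.proj (𝕜 := ℝ) j : E2 →L[ℝ] ℝ) (e2 i) = if j = i then 1 else 0 := coord_e2 i j
  have hi : inner ℝ x (e2 i) = x i := by simp [e2, EuclideanSpace.inner_single_right]
  simp only [_root_.smul_apply, _root_.add_apply, innerSL_apply_apply,
    hi, he, smul_eq_mul, Function.comp_apply]
  generalize (if j = i then (1 : ℝ) else 0) = c
  field_simp
  ring

lemma contDiff_ytest {h : ℝ} (hh : 0 < h) (Δ : ℝ) : ContDiff ℝ (⊤ : ℕ∞) (ytest h Δ) := by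
  rw [contDiff_euclidean]
  have hc : ∀ j : Fin 2, ContDiff ℝ (⊤ : ℕ∞) (fun z : E2 => z j) := fun j =>
    (EuclideanSpace.proj (𝕜 := ℝ) j : E2 →L[ℝ] ℝ).contDiff
  intro i
  fin_cases i
  · exact contDiff_const.mul (hc 0)
  · exact contDiff_const.mul (hc 1)
  · exact contDiff_const.mul (contDiff_rho hh)

lemma hessNormSq_ytest {h : ℝ} (hh : 0 < h) (Δ : ℝ) (x : E2) :
    hessNormSq (ytest h Δ) x =
      Δ ^ 2 * (1 / (‖x‖ ^ 2 + h ^ 2) + h ^ 4 / (‖x‖ ^ 2 + h ^ 2) ^ 3) := by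
  have z0 : ∀ (c : ℝ) (i j k : Fin 2), pd i (pd j (fun z : E2 => c * z k)) x = 0 := by
    intro c i j k
    have : pd j (fun z : E2 => c * z k) = fun _ => c * (if k = j then 1 else 0) := by
      funext z; rw [pd_coord]
    rw [this]; simp [pd]
  have e0 : (fun z => ytest h Δ z 0) = fun z : E2 => Real.sqrt (1 - Δ ^ 2) * z 0 := rfl
  have e1 : (fun z => ytest h Δ z 1) = fun z : E2 => Real.sqrt (1 - Δ ^ 2) * z 1 := rfl
  have e3 : (fun z => ytest h Δ z 2) = fun z : E2 => Δ * rho h z := rfl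
  unfold hessNormSq
  rw [Fin.sum_univ_three, e0, e1, e3]
  simp only [frob2, hess, Matrix.of_apply, z0, pd_pd_rho hh, Fin.sum_univ_two]
  have hr := rho_pos hh x
  have hs := rho_sq hh x
  have hn := norm_sq_E2 x
  rw [← hs]
  have hh2 : h ^ 4 = (rho h x ^ 2 - (x 0 ^ 2 + x 1 ^ 2)) ^ 2 := by rw [hs, hn]; ring
  rw [hh2]
  simp
  field_simp
  ring

lemma frob_ytest {h Δ : ℝ} (hh : 0 < h) (hΔ0 : 0 < Δ) (hΔ1 : Δ < 1) (x : E2) (hx : x ≠ 0) :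
    frob2 (gmet (ytest h Δ) x - gDelta Δ x) = Δ ^ 4 * h ^ 4 / (‖x‖ ^ 2 + h ^ 2) ^ 2 := by
  have e0 : (fun z => ytest h Δ z 0) = fun z : E2 => Real.sqrt (1 - Δ ^ 2) * z 0 := rfl
  have e1 : (fun z => ytest h Δ z 1) = fun z : E2 => Real.sqrt (1 - Δ ^ 2) * z 1 := rfl
  have e3 : (fun z => ytest h Δ z 2) = fun z : E2 => Δ * rho h z := rfl
  have hq : Real.sqrt (1 - Δ ^ 2) ^ 2 = 1 - Δ ^ 2 := Real.sq_sqrt (by nlinarith)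
  have hr := rho_pos hh x
  have hs := rho_sq hh x
  have hn := norm_sq_E2 x
  have hp : 0 < ‖x‖ ^ 2 := by have := norm_pos_iff.2 hx; positivity
  have hp' : 0 < x 0 ^ 2 + x 1 ^ 2 := hn ▸ hp
  have hp2 : 0 < x 0 ^ 2 + x 1 ^ 2 + h ^ 2 := by positivity
  have key : ∀ i j : Fin 2, (gmet (ytest h Δ) x - gDelta Δ x) i j =
      - Δ ^ 2 * h ^ 2 * (x i * x j) / ((x 0 ^ 2 + x 1 ^ 2) * (x 0 ^ 2 + x 1 ^ 2 + h ^ 2)) := by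
    intro i j
    simp only [gmet, Matrix.sub_apply, Matrix.mul_apply, Matrix.transpose_apply, Dmat,
      Matrix.of_apply, Fin.sum_univ_three, e0, e1, e3, pd_coord, pd_rho hh, gDelta]
    have : Δ * (x i / rho h x) * (Δ * (x j / rho h x)) =
        Δ ^ 2 * (x i * x j) / (x 0 ^ 2 + x 1 ^ 2 + h ^ 2) := by
      rw [← hn, ← hs]; field_simp
    rw [this, hn]
    generalize Real.sqrt (1 - Δ ^ 2) = q at hq ⊢
    fin_cases i <;> fin_cases j <;> simp [perpVec] <;> field_simp <;> (try simp only [hq]) <;> ring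
  simp only [frob2, Fin.sum_univ_two, key]
  rw [hn]
  field_simp

/-- Radial density. -/
def Frad (h Δ r : ℝ) : ℝ :=
  Δ ^ 4 * h ^ 4 / (r ^ 2 + h ^ 2) ^ 2 +
    h ^ 2 * (Δ ^ 2 * (1 / (r ^ 2 + h ^ 2) + h ^ 4 / (r ^ 2 + h ^ 2) ^ 3))

/-- Primitive of the radial density times the radius. -/
def Prad (h Δ r : ℝ) : ℝ :=
  Δ ^ 4 * h ^ 4 * (-(1 / 2) * (r ^ 2 + h ^ 2)⁻¹) +
    h ^ 2 * (Δ ^ 2 * (1 / 2 * Real.log (r ^ 2 + h ^ 2) - h ^ 4 / 4 * ((r ^ 2 + h ^ 2)⁻¹) ^ 2))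

lemma hasDerivAt_Prad {h : ℝ} (hh : 0 < h) (Δ r : ℝ) :
    HasDerivAt (Prad h Δ) (r * Frad h Δ r) r := by
  have hs : 0 < r ^ 2 + h ^ 2 := by positivity
  have d0 : HasDerivAt (fun r : ℝ => r ^ 2 + h ^ 2) (2 * r) r := by
    simpa using (hasDerivAt_pow 2 r).add_const (h ^ 2)
  have d1 := d0.inv hs.ne'
  have d2 := d0.log hs.ne'
  have d3 := ((d1.const_mul (-(1 / 2) : ℝ)).const_mul (Δ ^ 4 * h ^ 4)).add
    ((((d2.const_mul (1 / 2 : ℝ)).sub ((d1.pow 2).const_mul (h ^ 4 / 4))).const_mul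
      (Δ ^ 2)).const_mul (h ^ 2))
  refine HasDerivAt.congr_deriv (f := Prad h Δ) d3 ?_
  unfold Frad
  simp
  field_simp
  ring

lemma energy_ytest {h Δ : ℝ} (hh : 0 < h) (hΔ0 : 0 < Δ) (hΔ1 : Δ < 1) :
    energy h Δ (ytest h Δ) = 2 * π * (Prad h Δ 1 - Prad h Δ 0) := by
  have h0 : ∀ᵐ x : E2, x ≠ 0 := by
    have := measure_singleton (μ := (volume : Measure E2)) 0
    exact compl_mem_ae_iff.2 this
  have h1 : energy h Δ (ytest h Δ) = ∫ x in ball (0 : E2) 1, Frad h Δ ‖x‖ := by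
    unfold energy
    refine setIntegral_congr_ae measurableSet_ball ?_
    filter_upwards [h0] with x hx _
    rw [frob_ytest hh hΔ0 hΔ1 x hx, hessNormSq_ytest hh]
    rfl
  have h2 : ∫ x in ball (0 : E2) 1, Frad h Δ ‖x‖ =
      ∫ x : E2, (Set.Iio (1 : ℝ)).indicator (Frad h Δ) ‖x‖ := by
    rw [← integral_indicator measurableSet_ball]
    congr 1
    funext x
    by_cases hx : ‖x‖ < 1
    · rw [Set.indicator_of_mem (mem_ball_zero_iff.2 hx), Set.indicator_of_mem (Set.mem_Iio.2 hx)]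
    · rw [Set.indicator_of_notMem (fun h' => hx (mem_ball_zero_iff.1 h')),
        Set.indicator_of_notMem (fun h' => hx (Set.mem_Iio.1 h'))]
  have hv : (volume : Measure E2).real (ball 0 1) = π := by
    simp [Measure.real, EuclideanSpace.volume_ball_fin_two, Real.pi_pos.le]
  rw [h1, h2, integral_fun_norm_addHaar, hv]
  have h3 : ∫ r in Set.Ioi (0 : ℝ), r ^ (Module.finrank ℝ E2 - 1) •
      (Set.Iio (1 : ℝ)).indicator (Frad h Δ) r = ∫ r in (0 : ℝ)..1, r * Frad h Δ r := by
    have : (fun r : ℝ => r ^ (Module.finrank ℝ E2 - 1) •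
      (Set.Iio (1 : ℝ)).indicator (Frad h Δ) r) =
        (Set.Iio (1 : ℝ)).indicator (fun r => r * Frad h Δ r) := by
      funext r
      simp [Set.indicator_apply]
    rw [this, setIntegral_indicator measurableSet_Iio, Set.Ioi_inter_Iio,
      intervalIntegral.integral_of_le zero_le_one, integral_Ioc_eq_integral_Ioo]
  rw [h3, intervalIntegral.integral_eq_sub_of_hasDerivAt (fun r _ => hasDerivAt_Prad hh Δ r)]
  · simp; ring
  · apply Continuous.intervalIntegrable
    unfold Frad
    have : ∀ r : ℝ, r ^ 2 + h ^ 2 ≠ 0 := fun r => by positivity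
    fun_prop (disch := simp [this])

lemma energy_nonneg (h Δ : ℝ) (y : E2 → E3) : 0 ≤ energy h Δ y := by
  unfold energy hessNormSq frob2
  refine integral_nonneg fun x => ?_
  simp only [Pi.zero_apply]
  positivity

lemma energy_bound {h Δ : ℝ} (hh : 0 < h) (hh1 : h < 1) (hΔ0 : 0 < Δ) (hΔ1 : Δ < 1) :
    energy h Δ (ytest h Δ) ≤ 2 * π * Δ ^ 2 * h ^ 2 * (Real.log (1 / h) + 2) := by
  rw [energy_ytest hh hΔ0 hΔ1]
  have key : Prad h Δ 1 - Prad h Δ 0 ≤ Δ ^ 2 * h ^ 2 * (Real.log (1 / h) + 2) := by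
    have l1 : Real.log (1 ^ 2 + h ^ 2) ≤ 1 := by
      have := Real.log_le_sub_one_of_pos (show (0 : ℝ) < 1 ^ 2 + h ^ 2 by positivity)
      nlinarith
    have l2 : Real.log (0 ^ 2 + h ^ 2) = -(2 * Real.log (1 / h)) := by
      simp [Real.log_pow]
    have a1 : 0 ≤ (1 ^ 2 + h ^ 2)⁻¹ := by positivity
    have e : Prad h Δ 1 - Prad h Δ 0 = Δ ^ 2 * h ^ 2 * (Real.log (1 / h) +
        (Δ ^ 2 * (1 / 2 - h ^ 2 / 2 * (1 ^ 2 + h ^ 2)⁻¹) + 1 / 2 * Real.log (1 ^ 2 + h ^ 2) + 1 / 4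
          - h ^ 4 / 4 * ((1 ^ 2 + h ^ 2)⁻¹) ^ 2)) := by
      unfold Prad
      rw [l2]
      generalize (1 ^ 2 + h ^ 2)⁻¹ = a
      generalize Real.log (1 ^ 2 + h ^ 2) = b
      generalize Real.log (1 / h) = c
      field_simp
      ring
    rw [e]
    gcongr
    have b1 : 0 ≤ h ^ 2 / 2 * (1 ^ 2 + h ^ 2)⁻¹ := by positivity
    have b2 : 0 ≤ h ^ 4 / 4 * ((1 ^ 2 + h ^ 2)⁻¹) ^ 2 := by positivity
    have b3 : Δ ^ 2 * (1 / 2 - h ^ 2 / 2 * (1 ^ 2 + h ^ 2)⁻¹) ≤ 1 * (1 / 2) := by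
      have : Δ ^ 2 ≤ 1 := by nlinarith
      nlinarith [mul_nonneg (sq_nonneg Δ) b1]
    generalize Δ ^ 2 * (1 / 2 - h ^ 2 / 2 * (1 ^ 2 + h ^ 2)⁻¹) = u at *
    generalize h ^ 4 / 4 * ((1 ^ 2 + h ^ 2)⁻¹) ^ 2 = v at *
    generalize Real.log (1 ^ 2 + h ^ 2) = w at *
    linarith
  calc 2 * π * (Prad h Δ 1 - Prad h Δ 0)
      ≤ 2 * π * (Δ ^ 2 * h ^ 2 * (Real.log (1 / h) + 2)) := by gcongr
    _ = _ := by ring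

/-- upper bound for the elastic energy via a smooth test deformation;
consequently the infimum over `C²` maps is at most `2πΔ²h²(log(1/h)+C₂)`. -/
theorem stmt_1 (Δ : ℝ) (hΔ0 : 0 < Δ) (hΔ1 : Δ < 1) :
    ∃ C₂ > (0 : ℝ), ∃ h₀ ∈ Set.Ioo (0 : ℝ) 1, ∀ h ∈ Set.Ioo (0 : ℝ) h₀,
      (∃ y : E2 → E3, ContDiff ℝ (⊤ : ℕ∞) y ∧
          energy h Δ y ≤ 2 * π * Δ ^ 2 * h ^ 2 * (Real.log (1 / h) + C₂)) ∧
      sInf {E : ℝ | ∃ y : E2 → E3, ContDiff ℝ 2 y ∧ E = energy h Δ y} ≤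
        2 * π * Δ ^ 2 * h ^ 2 * (Real.log (1 / h) + C₂) := by
  refine ⟨2, two_pos, 1 / 2, ⟨by norm_num, by norm_num⟩, fun h hh => ?_⟩
  have hb := energy_bound hh.1 (lt_trans hh.2 (by norm_num)) hΔ0 hΔ1
  have hc := contDiff_ytest hh.1 Δ
  refine ⟨⟨ytest h Δ, hc, hb⟩, le_trans (csInf_le ?_ ?_) hb⟩
  · exact ⟨0, by rintro E ⟨y, -, rfl⟩; exact energy_nonneg h Δ y⟩
  · exact ⟨ytest h Δ, by exact_mod_cast contDiff_infty.1 hc 2, rfl⟩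
end
end
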